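/- Under the RA model with W irreducible, with y_t = a_t − x_t: for every agent i ∈ {1, …, N}, E[y_{t,i}^2] → 0 as t → ∞; that is, each component of y_t converges to 0 in mean square. -/

import Mathlib

open MeasureTheory ProbabilityTheory Filter

namespace RA

variable {Ω : Type*}

/-- History σ-algebra generated by `x 1, …, x t` and `a 1, …, a (t-1)`. -/
def hist {N : ℕ} [MeasurableSpace Ω] (x a : ℕ → Ω → Fin N → ℝ) (t : ℕ) :
    MeasurableSpace Ω :=
  (⨆ s ∈ Finset.Icc 1 t, MeasurableSpace.comap (x s) inferInstance) ⊔
  (⨆ s ∈ Finset.Ico 1 t, MeasurableSpace.comap (a s) inferInstance)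

/-- The Random Actions (RA) opinion dynamics model. -/
structure IsRAModel {N : ℕ} [MeasurableSpace Ω] (μ : Measure Ω) (α : ℝ)
    (W : Matrix (Fin N) (Fin N) ℝ) (x a : ℕ → Ω → Fin N → ℝ) : Prop where
  isProb : IsProbabilityMeasure μ
  alpha_mem : α ∈ Set.Ioo (0 : ℝ) 1
  W_nonneg : ∀ i j, 0 ≤ W i j
  W_rowsum : ∀ i, ∑ j, W i j = 1
  x_meas : ∀ t, Measurable (x t)
  a_meas : ∀ t, Measurable (a t)
  x_mem : ∀ t, 1 ≤ t → ∀ ω i, x t ω i ∈ Set.Icc (0 : ℝ) 1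
  a_mem : ∀ t, 1 ≤ t → ∀ ω i, a t ω i = 0 ∨ a t ω i = 1
  update : ∀ t, 1 ≤ t → ∀ ω i,
    x (t + 1) ω i = (1 - α) * x t ω i + α * ∑ j, W i j * a t ω j
  bernoulli : ∀ t, 1 ≤ t → ∀ b : Fin N → Bool, ∀ H : Set Ω,
    MeasurableSet[hist x a t] H →
    (μ (H ∩ {ω | ∀ i, a t ω i = if b i then (1 : ℝ) else 0})).toReal
      = ∫ ω in H, ∏ i, (if b i then x t ω i else 1 - x t ω i) ∂μ

/-- `W` is irreducible: the network is strongly connected. -/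
def Irreducible {N : ℕ} (W : Matrix (Fin N) (Fin N) ℝ) : Prop :=
  ∀ i j, ∃ n : ℕ, 0 < (W ^ n) i j

/-- The event that `x t i ∈ [0,δ) ∪ (1-δ,1]`. -/
def cti {N : ℕ} (x : ℕ → Ω → Fin N → ℝ) (δ : ℝ) (t : ℕ) (i : Fin N) : Set Ω :=
  {ω | x t ω i < δ ∨ 1 - δ < x t ω i}

def ct {N : ℕ} (x : ℕ → Ω → Fin N → ℝ) (δ : ℝ) (t : ℕ) : Set Ω :=
  ⋂ i, cti x δ t i

def c0 {N : ℕ} (x : ℕ → Ω → Fin N → ℝ) (δ : ℝ) (t : ℕ) (i : Fin N) : Set Ω :=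
  {ω | x t ω i < δ}

def c1 {N : ℕ} (x : ℕ → Ω → Fin N → ℝ) (δ : ℝ) (t : ℕ) (i : Fin N) : Set Ω :=
  {ω | 1 - δ < x t ω i}

/-- The event that every coordinate of `x t` is within `δ` of `0`. -/
def corner0 {N : ℕ} (x : ℕ → Ω → Fin N → ℝ) (δ : ℝ) (t : ℕ) : Set Ω :=
  {ω | ∀ i, x t ω i < δ}

/-- The event that every coordinate of `x t` is within `δ` of `1`. -/
def corner1 {N : ℕ} (x : ℕ → Ω → Fin N → ℝ) (δ : ℝ) (t : ℕ) : Set Ω :=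
  {ω | ∀ i, 1 - δ < x t ω i}

/-- Agents `i` and `j` communicate. -/
def Communicates {N : ℕ} (W : Matrix (Fin N) (Fin N) ℝ) (i j : Fin N) : Prop :=
  (∃ n : ℕ, 0 < (W ^ n) j i) ∧ (∃ n : ℕ, 0 < (W ^ n) i j)

/-- `C` is a communication class (strongly connected component). -/
def CommClass {N : ℕ} (W : Matrix (Fin N) (Fin N) ℝ) (C : Set (Fin N)) : Prop :=
  ∃ i, C = {j | Communicates W i j}

/-- `C` is a maximal communication class: no agent outside `C` has a directed
path into `C`. -/
def IsMaximalClass {N : ℕ} (W : Matrix (Fin N) (Fin N) ℝ) (C : Set (Fin N)) : Prop :=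
  CommClass W C ∧ ∀ i ∈ C, ∀ j, (∃ n : ℕ, 0 < (W ^ n) i j) → j ∈ C

/-- An irreducible row-stochastic matrix has a left fixed vector with no zero entry. -/
theorem exists_left_fixed_vector {N : ℕ} (hN : 1 ≤ N) (W : Matrix (Fin N) (Fin N) ℝ)
    (hnonneg : ∀ i j, 0 ≤ W i j) (hsum : ∀ i, ∑ j, W i j = 1) (hirr : Irreducible W) :
    ∃ v : Fin N → ℝ, (∀ i, v i ≠ 0) ∧ ∀ j, ∑ i, v i * W i j = v j := by
  have : Nonempty (Fin N) := ⟨⟨0, hN⟩⟩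
  have hdet : (W - 1).det = 0 := by
    rw [← Matrix.exists_mulVec_eq_zero_iff]
    refine ⟨fun _ => 1, fun h => one_ne_zero (congrFun h (Classical.arbitrary _)), ?_⟩
    ext i
    simp [Matrix.mulVec, dotProduct, hsum, Matrix.one_apply]
  obtain ⟨v, hv0, hv⟩ := Matrix.exists_vecMul_eq_zero_iff.mpr hdet
  have hfix : ∀ j, ∑ i, v i * W i j = v j := by
    intro j
    have h := congrFun hv j
    rw [Matrix.vecMul_sub, Matrix.vecMul_one] at h
    simpa [Matrix.vecMul, dotProduct, sub_eq_zero] using h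
  have hle : ∀ j ∈ Finset.univ, |v j| ≤ ∑ i, |v i| * W i j := by
    intro j _
    calc |v j| = |∑ i, v i * W i j| := by rw [hfix]
      _ ≤ ∑ i, |v i * W i j| := Finset.abs_sum_le_sum_abs _ _
      _ = _ := by simp [abs_mul, abs_of_nonneg (hnonneg _ _)]
  have htot : ∑ j, |v j| = ∑ j, ∑ i, |v i| * W i j := by
    rw [Finset.sum_comm]
    simp [← Finset.mul_sum, hsum]
  have habs : Matrix.vecMul (fun i => |v i|) W = fun i => |v i| := by
    ext j
    exact ((Finset.sum_eq_sum_iff_of_le hle).mp htot j (Finset.mem_univ j)).symm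
  have hpow : ∀ n, Matrix.vecMul (fun i => |v i|) (W ^ n) = fun i => |v i| := by
    intro n
    induction n with
    | zero => simp
    | succ n ih => rw [pow_succ, ← Matrix.vecMul_vecMul, ih, habs]
  have hpow_nonneg : ∀ n i j, 0 ≤ (W ^ n) i j := by
    intro n
    induction n with
    | zero => intro i j; simp only [pow_zero, Matrix.one_apply]; split_ifs <;> norm_num
    | succ n ih =>
      intro i j
      rw [pow_succ, Matrix.mul_apply]
      exact Finset.sum_nonneg fun k _ => mul_nonneg (ih i k) (hnonneg k j)
  refine ⟨v, fun j hj => hv0 ?_, hfix⟩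
  ext i
  obtain ⟨n, hn⟩ := hirr i j
  have h : ∑ k, |v k| * (W ^ n) k j = 0 := by
    simpa [Matrix.vecMul, dotProduct, hj] using congrFun (hpow n) j
  rw [Finset.sum_eq_zero_iff_of_nonneg
    fun k _ => mul_nonneg (abs_nonneg _) (hpow_nonneg n k j)] at h
  simpa [hn.ne'] using h i (Finset.mem_univ i)

/-- The probability of the outcome `b` under independent Bernoulli coordinates with success
probabilities `z`. -/
def bernoulliWeight {N : ℕ} (z : Fin N → ℝ) (b : Fin N → Bool) : ℝ :=
  ∏ i, if b i then z i else 1 - z i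

/-- A Boolean vector read as a real vector with entries `0` and `1`. -/
def boolVec {N : ℕ} (b : Fin N → Bool) (i : Fin N) : ℝ := if b i then 1 else 0

theorem sum_bernoulliWeight_mul_prod {N : ℕ} (z : Fin N → ℝ) (h : Fin N → Bool → ℝ) :
    ∑ b, bernoulliWeight z b * ∏ i, h i (b i)
      = ∏ i, (z i * h i true + (1 - z i) * h i false) := by
  simp only [bernoulliWeight, ← Finset.prod_mul_distrib]
  rw [← Fintype.prod_sum fun i c => (if c = true then z i else 1 - z i) * h i c]
  simp

theorem sum_bernoulliWeight {N : ℕ} (z : Fin N → ℝ) : ∑ b, bernoulliWeight z b = 1 := by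
  simpa using sum_bernoulliWeight_mul_prod z fun _ _ => 1

theorem sum_bernoulliWeight_mul_centered {N : ℕ} (z : Fin N → ℝ) (i : Fin N) :
    ∑ b, bernoulliWeight z b * (boolVec b i - z i) = 0 := by
  have h := sum_bernoulliWeight_mul_prod z
    fun k c => if k = i then (if c then 1 else 0) - z k else 1
  simp only [Finset.prod_ite_eq', Finset.mem_univ, if_true] at h
  refine h.trans (Finset.prod_eq_zero (Finset.mem_univ i) ?_)
  simp
  ring

theorem sum_bernoulliWeight_mul_centered_mul_centered {N : ℕ} (z : Fin N → ℝ) (i j : Fin N) :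
    ∑ b, bernoulliWeight z b * ((boolVec b i - z i) * (boolVec b j - z j))
      = if i = j then z i * (1 - z i) else 0 := by
  have h := sum_bernoulliWeight_mul_prod z fun k c =>
    (if k = i then (if c then 1 else 0) - z k else 1) *
      (if k = j then (if c then 1 else 0) - z k else 1)
  simp only [Finset.prod_mul_distrib, Finset.prod_ite_eq', Finset.mem_univ, if_true] at h
  refine h.trans ?_
  by_cases hij : i = j
  · subst hij
    rw [if_pos rfl, Finset.prod_eq_single i (fun k _ hk => by simp [hk]) (by simp)]
    simp
    ring
  · rw [if_neg hij]
    refine Finset.prod_eq_zero (Finset.mem_univ i) ?_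
    simp [hij]
    ring

theorem sum_bernoulliWeight_mul_sq {N : ℕ} (z v : Fin N → ℝ) (m α : ℝ) :
    ∑ b, bernoulliWeight z b * (m + α * ∑ i, v i * (boolVec b i - z i)) ^ 2
      = m ^ 2 + α ^ 2 * ∑ i, v i ^ 2 * (z i * (1 - z i)) := by
  have h1 : ∑ b, bernoulliWeight z b * ∑ i, v i * (boolVec b i - z i) = 0 := by
    simp_rw [Finset.mul_sum, mul_left_comm _ (v _)]
    rw [Finset.sum_comm]
    simp_rw [← Finset.mul_sum, sum_bernoulliWeight_mul_centered]
    simp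
  have h2 : ∑ b, bernoulliWeight z b * (∑ i, v i * (boolVec b i - z i)) ^ 2
      = ∑ i, v i ^ 2 * (z i * (1 - z i)) := by
    simp_rw [sq (∑ i, v i * (boolVec _ i - z i)), Finset.sum_mul_sum, Finset.mul_sum]
    rw [Finset.sum_comm]
    refine Finset.sum_congr rfl fun i _ => ?_
    rw [Finset.sum_comm]
    have h : ∀ j, ∑ b, bernoulliWeight z b *
        (v i * (boolVec b i - z i) * (v j * (boolVec b j - z j)))
        = v i * v j * if i = j then z i * (1 - z i) else 0 := by
      intro j
      rw [← sum_bernoulliWeight_mul_centered_mul_centered, Finset.mul_sum]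
      exact Finset.sum_congr rfl fun b _ => by ring
    simp [h, sq]
  calc _ = ∑ b, (m ^ 2 * bernoulliWeight z b
        + 2 * m * α * (bernoulliWeight z b * ∑ i, v i * (boolVec b i - z i))
        + α ^ 2 * (bernoulliWeight z b * (∑ i, v i * (boolVec b i - z i)) ^ 2)) :=
        Finset.sum_congr rfl fun b _ => by ring
    _ = _ := by
      rw [Finset.sum_add_distrib, Finset.sum_add_distrib, ← Finset.mul_sum, ← Finset.mul_sum,
        ← Finset.mul_sum, sum_bernoulliWeight, h1, h2]
      ring

/-- If `p` integrates over every `m`-measurable set to the measure of its intersection with `A`,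
then `p` may replace the indicator of `A` when integrating against `m`-measurable functions. -/
theorem integral_mul_indicator_eq {m m0 : MeasurableSpace Ω} (hm : m ≤ m0) (μ : Measure Ω)
    [IsFiniteMeasure μ] {A : Set Ω} (hA : MeasurableSet A) {p g : Ω → ℝ}
    (hp : StronglyMeasurable[m] p) (hpint : Integrable p μ) (hg : StronglyMeasurable[m] g)
    {C : ℝ} (hgC : ∀ ω, |g ω| ≤ C)
    (h : ∀ H, MeasurableSet[m] H → (μ (H ∩ A)).toReal = ∫ ω in H, p ω ∂μ) :
    ∫ ω, g ω * A.indicator (fun _ => 1) ω ∂μ = ∫ ω, g ω * p ω ∂μ := by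
  have hind : Integrable (A.indicator fun _ => (1 : ℝ)) μ := (integrable_const 1).indicator hA
  have hcond : p =ᵐ[μ] μ[A.indicator fun _ => (1 : ℝ)|m] := by
    refine ae_eq_condExp_of_forall_setIntegral_eq hm hind (fun _ _ _ => hpint.integrableOn) ?_
      hp.aestronglyMeasurable
    intro H hH _
    rw [← h H hH, setIntegral_indicator hA]
    simp [Measure.real]
  have hmul : Integrable (g * A.indicator fun _ => (1 : ℝ)) μ :=
    hind.bdd_mul (hg.mono hm).aestronglyMeasurable (ae_of_all _ hgC)
  have hpull := condExp_mul_of_stronglyMeasurable_left hg hmul hind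
  calc _ = ∫ ω, (μ[g * A.indicator fun _ => (1 : ℝ)|m]) ω ∂μ := (integral_condExp hm).symm
    _ = _ := integral_congr_ae <| by
      filter_upwards [hpull, hcond] with ω h1 h2
      rw [h1, Pi.mul_apply, ← h2]

theorem hist_le {N : ℕ} [MeasurableSpace Ω] {x a : ℕ → Ω → Fin N → ℝ}
    (hx : ∀ t, Measurable (x t)) (ha : ∀ t, Measurable (a t)) (t : ℕ) :
    hist x a t ≤ ‹MeasurableSpace Ω› :=
  sup_le (iSup₂_le fun s _ => (hx s).comap_le) (iSup₂_le fun s _ => (ha s).comap_le)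

theorem measurable_hist {N : ℕ} [MeasurableSpace Ω] (x a : ℕ → Ω → Fin N → ℝ) {t : ℕ}
    (ht : 1 ≤ t) : Measurable[hist x a t] (x t) :=
  Measurable.of_comap_le <| le_sup_of_le_left <|
    le_iSup₂_of_le (f := fun s (_ : s ∈ Finset.Icc 1 t) =>
      MeasurableSpace.comap (x s) inferInstance) t (Finset.mem_Icc.mpr ⟨ht, le_rfl⟩) le_rfl

theorem continuous_bernoulliWeight {N : ℕ} (b : Fin N → Bool) :
    Continuous fun z : Fin N → ℝ => bernoulliWeight z b := by
  refine continuous_finsetProd _ fun i _ => ?_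
  split_ifs <;> fun_prop

namespace IsRAModel

variable {N : ℕ} [MeasurableSpace Ω] {μ : Measure Ω} {α : ℝ} {W : Matrix (Fin N) (Fin N) ℝ}
  {x a : ℕ → Ω → Fin N → ℝ}

theorem exists_bound (hRA : IsRAModel μ α W x a) {t : ℕ} (ht : 1 ≤ t)
    {f : (Fin N → ℝ) → ℝ} (hf : Continuous f) : ∃ C, ∀ ω, |f (x t ω)| ≤ C := by
  obtain ⟨C, hC⟩ := (isCompact_univ_pi fun _ : Fin N =>
    isCompact_Icc (a := (0 : ℝ)) (b := 1)).exists_bound_of_continuousOn hf.continuousOn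
  exact ⟨C, fun ω => hC _ fun i _ => hRA.x_mem t ht ω i⟩

theorem integrable_comp (hRA : IsRAModel μ α W x a) {t : ℕ} (ht : 1 ≤ t)
    {f : (Fin N → ℝ) → ℝ} (hf : Continuous f) : Integrable (fun ω => f (x t ω)) μ := by
  have := hRA.isProb
  obtain ⟨C, hC⟩ := hRA.exists_bound ht hf
  exact .of_bound (hf.measurable.comp (hRA.x_meas t)).aestronglyMeasurable C (ae_of_all _ hC)

/-- Averaging out the action vector given the opinion vector. -/
theorem integral_comp (hRA : IsRAModel μ α W x a) {t : ℕ} (ht : 1 ≤ t)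
    {G : (Fin N → ℝ) → (Fin N → ℝ) → ℝ} (hG : ∀ c, Continuous fun z => G z c) :
    ∫ ω, G (x t ω) (a t ω) ∂μ
      = ∫ ω, ∑ b, bernoulliWeight (x t ω) b * G (x t ω) (boolVec b) ∂μ := by
  have := hRA.isProb
  set A : (Fin N → Bool) → Set Ω := fun b => {ω | ∀ i, a t ω i = if b i then (1 : ℝ) else 0}
    with hAdef
  have hA : ∀ b, MeasurableSet (A b) := by
    intro b
    simp only [hAdef, Set.ofPred_forall]
    exact .iInter fun i =>
      measurableSet_eq_fun ((measurable_pi_apply i).comp (hRA.a_meas t)) measurable_const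
  have hsplit : ∀ ω, G (x t ω) (a t ω)
      = ∑ b, G (x t ω) (boolVec b) * (A b).indicator (fun _ => 1) ω := by
    intro ω
    have hmem : ∀ b, ω ∈ A b ↔ a t ω = boolVec b := fun b => funext_iff.symm
    have ha : a t ω = boolVec fun i => decide (a t ω i = 1) := by
      ext i
      rcases hRA.a_mem t ht ω i with h | h <;> simp [boolVec, h]
    rw [Finset.sum_eq_single fun i => decide (a t ω i = 1)]
    · rw [Set.indicator_of_mem ((hmem _).mpr ha), mul_one, ← ha]
    · intro b _ hb
      rw [Set.indicator_of_notMem, mul_zero]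
      intro h
      refine hb (funext fun i => ?_)
      rw [(hmem b).mp h]
      cases hbi : b i <;> simp [boolVec, hbi]
    · simp
  simp_rw [hsplit]
  rw [integral_finsetSum, integral_finsetSum]
  · refine Finset.sum_congr rfl fun b _ => ?_
    obtain ⟨C, hC⟩ := hRA.exists_bound ht (hG (boolVec b))
    have hx := measurable_hist x a ht
    rw [integral_mul_indicator_eq (hist_le hRA.x_meas hRA.a_meas t) μ (hA b)
      (p := fun ω => bernoulliWeight (x t ω) b)
      (g := fun ω => G (x t ω) (boolVec b))
      ((continuous_bernoulliWeight b).measurable.comp hx).stronglyMeasurable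
      (hRA.integrable_comp ht (continuous_bernoulliWeight b))
      ((hG (boolVec b)).measurable.comp hx).stronglyMeasurable hC (hRA.bernoulli t ht b)]
    simp_rw [mul_comm]
  · exact fun b _ => hRA.integrable_comp ht ((continuous_bernoulliWeight b).mul (hG _))
  · intro b _
    obtain ⟨C, hC⟩ := hRA.exists_bound ht (hG (boolVec b))
    exact ((integrable_const (1 : ℝ)).indicator (hA b)).bdd_mul
      (hRA.integrable_comp ht (hG (boolVec b))).aestronglyMeasurable (ae_of_all _ hC)

theorem integral_centered_sq (hRA : IsRAModel μ α W x a) {t : ℕ} (ht : 1 ≤ t) (i : Fin N) :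
    ∫ ω, (a t ω i - x t ω i) ^ 2 ∂μ = ∫ ω, x t ω i * (1 - x t ω i) ∂μ := by
  rw [hRA.integral_comp ht (G := fun z c => (c i - z i) ^ 2) fun c => by fun_prop]
  refine integral_congr_ae (ae_of_all _ fun ω => ?_)
  simpa [sq] using sum_bernoulliWeight_mul_centered_mul_centered (x t ω) i i

/-- For a left fixed vector `v`, the second moment of the martingale `∑ i, v i * x t i` grows by
the weighted second moments of `a t i - x t i`. -/
theorem integral_sq_succ (hRA : IsRAModel μ α W x a) {v : Fin N → ℝ}
    (hv : ∀ j, ∑ i, v i * W i j = v j) {t : ℕ} (ht : 1 ≤ t) :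
    ∫ ω, (∑ i, v i * x (t + 1) ω i) ^ 2 ∂μ = ∫ ω, (∑ i, v i * x t ω i) ^ 2 ∂μ
      + α ^ 2 * ∑ i, v i ^ 2 * ∫ ω, (a t ω i - x t ω i) ^ 2 ∂μ := by
  have hstep : ∀ ω, ∑ i, v i * x (t + 1) ω i
      = ∑ i, v i * x t ω i + α * ∑ i, v i * (a t ω i - x t ω i) := by
    intro ω
    have hva : ∑ i, v i * ∑ j, W i j * a t ω j = ∑ j, v j * a t ω j := by
      simp_rw [Finset.mul_sum, ← mul_assoc]
      rw [Finset.sum_comm]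
      simp_rw [← Finset.sum_mul, hv]
    simp_rw [hRA.update t ht, mul_sub, mul_add, Finset.sum_add_distrib, Finset.sum_sub_distrib,
      mul_left_comm (v _), ← Finset.mul_sum, hva]
    ring
  simp_rw [hstep]
  rw [hRA.integral_comp ht
    (G := fun z c => (∑ i, v i * z i + α * ∑ i, v i * (c i - z i)) ^ 2) fun c => by fun_prop]
  simp_rw [sum_bernoulliWeight_mul_sq, hRA.integral_centered_sq ht]
  have hint : ∀ i, Integrable (fun ω => v i ^ 2 * (x t ω i * (1 - x t ω i))) μ := fun i =>
    hRA.integrable_comp ht (f := fun z => v i ^ 2 * (z i * (1 - z i))) (by fun_prop)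
  rw [integral_add
    (hRA.integrable_comp ht (f := fun z => (∑ i, v i * z i) ^ 2) (by fun_prop))
    ((integrable_finsetSum _ fun i _ => hint i).const_mul _), integral_const_mul,
    integral_finsetSum _ fun i _ => hint i]
  simp_rw [integral_const_mul]

theorem summable_integral_centered_sq (hRA : IsRAModel μ α W x a) {v : Fin N → ℝ}
    (hv : ∀ j, ∑ i, v i * W i j = v j) {i : Fin N} (hvi : v i ≠ 0) :
    Summable fun t => ∫ ω, (a (t + 1) ω i - x (t + 1) ω i) ^ 2 ∂μ := by
  have := hRA.isProb
  have hα : 0 < α ^ 2 * v i ^ 2 := by have := hRA.alpha_mem.1; positivity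
  have hnonneg : ∀ t k, 0 ≤ ∫ ω, (a t ω k - x t ω k) ^ 2 ∂μ := fun t k =>
    integral_nonneg fun ω => sq_nonneg _
  have hbound : ∀ n, ∫ ω, (∑ i, v i * x (n + 1) ω i) ^ 2 ∂μ ≤ (∑ i, |v i|) ^ 2 := by
    intro n
    have hn : 1 ≤ n + 1 := Nat.le_add_left 1 n
    calc _ ≤ ∫ _, (∑ i, |v i|) ^ 2 ∂μ := by
          refine integral_mono (hRA.integrable_comp hn (f := fun z => (∑ i, v i * z i) ^ 2)
            (by fun_prop)) (integrable_const _) fun ω => ?_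
          refine sq_le_sq' (abs_le.mp ?_).1 (abs_le.mp ?_).2 <;>
          · refine (Finset.abs_sum_le_sum_abs _ _).trans (Finset.sum_le_sum fun k _ => ?_)
            have hk := hRA.x_mem _ hn ω k
            rw [abs_mul, abs_of_nonneg hk.1]
            exact mul_le_of_le_one_right (abs_nonneg _) hk.2
      _ = _ := by simp
  have htele : ∀ n, α ^ 2 * v i ^ 2 *
      ∑ t ∈ Finset.range n, ∫ ω, (a (t + 1) ω i - x (t + 1) ω i) ^ 2 ∂μ
      ≤ ∫ ω, (∑ i, v i * x (n + 1) ω i) ^ 2 ∂μ := by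
    intro n
    induction n with
    | zero => simpa using integral_nonneg fun ω => sq_nonneg _
    | succ n ih =>
      rw [Finset.sum_range_succ, mul_add, hRA.integral_sq_succ hv (Nat.le_add_left 1 n),
        mul_assoc _ _ (∫ _, _ ∂μ)]
      refine add_le_add ih (mul_le_mul_of_nonneg_left ?_ (sq_nonneg α))
      exact Finset.single_le_sum
        (f := fun k => v k ^ 2 * ∫ ω, (a (n + 1) ω k - x (n + 1) ω k) ^ 2 ∂μ)
        (fun k _ => mul_nonneg (sq_nonneg _) (hnonneg _ k)) (Finset.mem_univ i)
  refine summable_of_sum_range_le (c := (∑ i, |v i|) ^ 2 / (α ^ 2 * v i ^ 2))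
    (fun t => hnonneg _ i) fun n => ?_
  rw [le_div_iff₀' hα]
  exact (htele n).trans (hbound n)

end IsRAModel

theorem y_tends_to_zero_in_mean_square {Ω : Type*} [MeasurableSpace Ω] {N : ℕ} (hN : 1 ≤ N)
    (μ : Measure Ω) (α : ℝ) (W : Matrix (Fin N) (Fin N) ℝ)
    (x a : ℕ → Ω → Fin N → ℝ) (hRA : IsRAModel μ α W x a)
    (hirr : Irreducible W) :
    ∀ i : Fin N,
      Filter.Tendsto (fun t => ∫ ω, (a t ω i - x t ω i) ^ 2 ∂μ)
        Filter.atTop (nhds 0) := by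
  intro i
  obtain ⟨v, hv0, hv⟩ := exists_left_fixed_vector hN W hRA.W_nonneg hRA.W_rowsum hirr
  exact (tendsto_add_atTop_iff_nat 1).mp
    (hRA.summable_integral_centered_sq hv (hv0 i)).tendsto_atTop_zero

end RA
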